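/- arXiv:1309.0651 — 4 statements merged into one kernel-verified Lean document; each statement's English description precedes it below -/
import Mathlib

section
/- Consider a point of the line-network branch flow model with v_j > 0 for all buses j, and suppose p_j < 0 for every load bus 1 ≤ j ≤ n. Then the interleaved sequence of directed real line flows P_0, −P′_0, P_1, −P′_1, …, P_n, −P′_n is nonincreasing; more precisely, P_j ≥ −P′_j for every line 0 ≤ j ≤ n, and −P′_{j−1} > P_j (strictly) for every load bus 1 ≤ j ≤ n. -/
/-- Branch flow model equations on a line network with buses `0,…,n+1`
(bus `0` and bus `n+1` are substations) and lines `0,…,n`, where line `j`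
joins bus `j` to bus `j+1` with resistance `r j` and reactance `x j`. -/
def BFMEq (n : ℕ) (r x p q P Q ℓ v : ℕ → ℝ) : Prop :=
  p 0 = P 0 ∧ q 0 = Q 0 ∧
  (∀ j, 1 ≤ j → j ≤ n → p j = P j - (P (j-1) - ℓ (j-1) * r (j-1))) ∧
  (∀ j, 1 ≤ j → j ≤ n → q j = Q j - (Q (j-1) - ℓ (j-1) * x (j-1))) ∧
  p (n+1) = -(P n - ℓ n * r n) ∧
  q (n+1) = -(Q n - ℓ n * x n) ∧
  (∀ j, j ≤ n → v (j+1) = v j - 2*(r j * P j + x j * Q j) + ℓ j * ((r j)^2 + (x j)^2)) ∧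
  (∀ j, j ≤ n → ℓ j * v j = (P j)^2 + (Q j)^2)

/-- The interleaved sequence of directed real line flows
`P 0, -P' 0, P 1, -P' 1, …, P n, -P' n` (where `P' j = -P j + ℓ j * r j` is the
reverse real flow on line `j`) is nonincreasing: `P j ≥ -P' j` on every line,
and `-P' (j-1) > P j` strictly across every load bus. -/
theorem stmt0 (n : ℕ) (hn : 1 ≤ n) (r x p q P Q ℓ v : ℕ → ℝ)
    (hr : ∀ j, j ≤ n → 0 < r j) (hx : ∀ j, j ≤ n → 0 < x j)
    (hbfm : BFMEq n r x p q P Q ℓ v)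
    (hv : ∀ j, j ≤ n+1 → 0 < v j)
    (hp : ∀ j, 1 ≤ j → j ≤ n → p j < 0) :
    (∀ j, j ≤ n → P j ≥ -(-(P j) + ℓ j * r j)) ∧
    (∀ j, 1 ≤ j → j ≤ n → -(-(P (j-1)) + ℓ (j-1) * r (j-1)) > P j) := by
  obtain ⟨-, -, hbal, -, -, -, -, hcur⟩ := hbfm
  refine ⟨fun j hj => ?_, fun j h1 hj => ?_⟩
  · have hℓ : 0 ≤ ℓ j := by
      refine nonneg_of_mul_nonneg_left ?_ (hv j (by omega))
      rw [hcur j hj]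
      positivity
    have := mul_nonneg hℓ (hr j hj).le
    linarith
  · linarith [hp j h1 hj, hbal j h1 hj]
end

section
/- Consider a point of the line-network branch flow model with v_j > 0 for all buses j, and suppose p_j < 0 for every load bus 1 ≤ j ≤ n. Then there is at most one line with zero current: there do not exist lines j₁ < j₂ with ℓ_{j₁} = 0 and ℓ_{j₂} = 0. (Equivalently, there do not exist two distinct lines j with P_j = −P′_j.) -/
/-- There is at most one line with zero current: no two distinct lines `j₁ < j₂`
both have `ℓ j₁ = 0` and `ℓ j₂ = 0`. -/
theorem stmt1 (n : ℕ) (hn : 1 ≤ n) (r x p q P Q ℓ v : ℕ → ℝ)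
    (hr : ∀ j, j ≤ n → 0 < r j) (hx : ∀ j, j ≤ n → 0 < x j)
    (hbfm : BFMEq n r x p q P Q ℓ v)
    (hv : ∀ j, j ≤ n+1 → 0 < v j)
    (hp : ∀ j, 1 ≤ j → j ≤ n → p j < 0) :
    ¬ ∃ j₁ j₂ : ℕ, j₁ < j₂ ∧ j₂ ≤ n ∧ ℓ j₁ = 0 ∧ ℓ j₂ = 0 := by
  obtain ⟨-, -, hP, -, -, -, -, hcur⟩ := hbfm
  have power_zero : ∀ j, j ≤ n → ℓ j = 0 → P j = 0 := by
    intro j hj h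
    have := hcur j hj
    rw [h] at this
    nlinarith [sq_nonneg (P j), sq_nonneg (Q j)]
  have loss_nonneg : ∀ j, j ≤ n → 0 ≤ ℓ j * r j := by
    intro j hj
    refine mul_nonneg (nonneg_of_mul_nonneg_left ?_ (hv j (by omega))) (hr j hj).le
    rw [hcur j hj]
    positivity
  rintro ⟨j₁, j₂, hlt, hj₂, h₁, h₂⟩
  have hneg : ∀ j, j₁ + 1 ≤ j → j ≤ n → P j < 0 := by
    intro j hj
    induction j, hj using Nat.le_induction with
    | base =>
      intro hjn
      have e := hP (j₁ + 1) (by omega) hjn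
      rw [Nat.add_sub_cancel, h₁, power_zero j₁ (by omega) h₁] at e
      linarith [hp (j₁ + 1) (by omega) hjn]
    | succ k hk ih =>
      intro hkn
      have e := hP (k + 1) (by omega) hkn
      rw [Nat.add_sub_cancel] at e
      linarith [hp (k + 1) (by omega) hkn, ih (by omega), loss_nonneg k (by omega)]
  exact (hneg j₂ hlt hj₂).ne (power_zero j₂ hj₂ h₂)
end

section
/- (Theorem 1, part 2) In the line-network branch flow model with fixed voltage magnitudes (v_j equal to a given constant v̄_j = v̲_j > 0 for every bus j), let Γ : ℝ² → ℝ be a convex function and consider minimizing Γ(p_0, p_{n+1}) over the SOCP-relaxed feasible set X_c. Suppose the relaxation is exact, i.e., every minimizer satisfies ℓ_j v_j = P_j² + Q_j² for every line j. Then the minimizer is unique: any two optimal solutions of this problem are equal as tuples (p, q, P, Q, ℓ, v). -/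
/-- A point of the (relaxed) branch flow model: injections `p, q`, branch flows
`P, Q`, squared current magnitudes `l` and squared voltage magnitudes `v`. -/
structure Pt where
  p : ℕ → ℝ
  q : ℕ → ℝ
  P : ℕ → ℝ
  Q : ℕ → ℝ
  l : ℕ → ℝ
  v : ℕ → ℝ

/-- SOCP-relaxed branch flow equations on a line network with buses `0,…,n+1`
and lines `0,…,n`: the quadratic equality `ℓ v = P² + Q²` is replaced by the
inequalities `ℓ v ≥ P² + Q²` and `ℓ ≥ 0`. -/
def BFMRel (n : ℕ) (r x : ℕ → ℝ) (z : Pt) : Prop :=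
  z.p 0 = z.P 0 ∧ z.q 0 = z.Q 0 ∧
  (∀ j, 1 ≤ j → j ≤ n → z.p j = z.P j - (z.P (j-1) - z.l (j-1) * r (j-1))) ∧
  (∀ j, 1 ≤ j → j ≤ n → z.q j = z.Q j - (z.Q (j-1) - z.l (j-1) * x (j-1))) ∧
  z.p (n+1) = -(z.P n - z.l n * r n) ∧
  z.q (n+1) = -(z.Q n - z.l n * x n) ∧
  (∀ j, j ≤ n → z.v (j+1) = z.v j - 2*(r j * z.P j + x j * z.Q j) + z.l j * ((r j)^2 + (x j)^2)) ∧
  (∀ j, j ≤ n → z.l j * z.v j ≥ (z.P j)^2 + (z.Q j)^2) ∧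
  (∀ j, j ≤ n → 0 ≤ z.l j)

/-- The SOCP-relaxed feasible set `X_c`: relaxed branch flow equations together
with the box constraints on `p`, `q`, `v` and `ℓ`. -/
def InXc (n : ℕ) (r x plo phi qlo qhi vlo vhi lhi : ℕ → ℝ) (z : Pt) : Prop :=
  BFMRel n r x z ∧
  (∀ j, j ≤ n+1 → plo j ≤ z.p j ∧ z.p j ≤ phi j) ∧
  (∀ j, j ≤ n+1 → qlo j ≤ z.q j ∧ z.q j ≤ qhi j) ∧
  (∀ j, j ≤ n+1 → vlo j ≤ z.v j ∧ z.v j ≤ vhi j) ∧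
  (∀ j, j ≤ n → z.l j ≤ lhi j)

/-- `z` minimizes `Γ (p 0, p (n+1))` over the SOCP-relaxed feasible set `X_c`. -/
def IsOptXc (n : ℕ) (r x plo phi qlo qhi vlo vhi lhi : ℕ → ℝ) (Γ : ℝ × ℝ → ℝ) (z : Pt) : Prop :=
  InXc n r x plo phi qlo qhi vlo vhi lhi z ∧
  ∀ w : Pt, InXc n r x plo phi qlo qhi vlo vhi lhi w →
    Γ (z.p 0, z.p (n+1)) ≤ Γ (w.p 0, w.p (n+1))

/-- The componentwise midpoint of two points. -/
noncomputable def Pt.mid (z w : Pt) : Pt where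
  p j := (z.p j + w.p j) / 2
  q j := (z.q j + w.q j) / 2
  P j := (z.P j + w.P j) / 2
  Q j := (z.Q j + w.Q j) / 2
  l j := (z.l j + w.l j) / 2
  v j := (z.v j + w.v j) / 2

/-- The relaxed branch flow equations are stable under midpoints of points with the same
voltages. -/
theorem BFMRel.mid {n : ℕ} {r x : ℕ → ℝ} {z w : Pt} (hz : BFMRel n r x z) (hw : BFMRel n r x w)
    (hv : ∀ j, j ≤ n → z.v j = w.v j) : BFMRel n r x (z.mid w) := by
  obtain ⟨a1, a2, a3, a4, a5, a6, a7, a8, a9⟩ := hz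
  obtain ⟨b1, b2, b3, b4, b5, b6, b7, b8, b9⟩ := hw
  simp only [BFMRel, Pt.mid]
  refine ⟨by linarith, by linarith, fun j h h' => ?_, fun j h h' => ?_, by linarith, by linarith,
    fun j h => ?_, fun j h => ?_, fun j h => ?_⟩
  · linarith [a3 j h h', b3 j h h']
  · linarith [a4 j h h', b4 j h h']
  · linarith [a7 j h, b7 j h]
  · have ha := a8 j h
    have hb := b8 j h
    rw [← hv j h] at hb ⊢
    nlinarith [sq_nonneg (z.P j - w.P j), sq_nonneg (z.Q j - w.Q j)]
  · linarith [a9 j h, b9 j h]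

theorem InXc.mid {n : ℕ} {r x plo phi qlo qhi vlo vhi lhi : ℕ → ℝ} {z w : Pt}
    (hz : InXc n r x plo phi qlo qhi vlo vhi lhi z)
    (hw : InXc n r x plo phi qlo qhi vlo vhi lhi w) (hv : ∀ j, j ≤ n → z.v j = w.v j) :
    InXc n r x plo phi qlo qhi vlo vhi lhi (z.mid w) := by
  obtain ⟨hz, a1, a2, a3, a4⟩ := hz
  obtain ⟨hw, b1, b2, b3, b4⟩ := hw
  refine ⟨hz.mid hw hv, fun j h => ?_, fun j h => ?_, fun j h => ?_, fun j h => ?_⟩ <;>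
    simp only [Pt.mid]
  · constructor <;> linarith [a1 j h, b1 j h]
  · constructor <;> linarith [a2 j h, b2 j h]
  · constructor <;> linarith [a3 j h, b3 j h]
  · linarith [a4 j h, b4 j h]

theorem IsOptXc.mid {n : ℕ} {r x plo phi qlo qhi vlo vhi lhi : ℕ → ℝ} {Γ : ℝ × ℝ → ℝ} {z w : Pt}
    (hΓ : ConvexOn ℝ Set.univ Γ)
    (hz : IsOptXc n r x plo phi qlo qhi vlo vhi lhi Γ z)
    (hw : IsOptXc n r x plo phi qlo qhi vlo vhi lhi Γ w) (hv : ∀ j, j ≤ n → z.v j = w.v j) :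
    IsOptXc n r x plo phi qlo qhi vlo vhi lhi Γ (z.mid w) := by
  refine ⟨hz.1.mid hw.1 hv, fun u hu => ?_⟩
  have hmid := hΓ.2 (Set.mem_univ (z.p 0, z.p (n + 1))) (Set.mem_univ (w.p 0, w.p (n + 1)))
    (by norm_num : (0 : ℝ) ≤ 1 / 2) (by norm_num : (0 : ℝ) ≤ 1 / 2) (by norm_num)
  have heq : ((z.mid w).p 0, (z.mid w).p (n + 1)) =
      (1 / 2 : ℝ) • (z.p 0, z.p (n + 1)) + (1 / 2 : ℝ) • (w.p 0, w.p (n + 1)) := by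
    ext <;> simp only [Pt.mid, Prod.fst_add, Prod.snd_add, Prod.smul_fst, Prod.smul_snd,
      smul_eq_mul] <;> ring
  rw [heq]
  simp only [smul_eq_mul] at hmid
  linarith [hz.2 u hu, hw.2 u hu]

/-- Theorem 1, part 2: with fixed voltage magnitudes, a convex objective, and
exactness of the relaxation at every minimizer, the minimizer is unique. -/
theorem stmt3 (n : ℕ) (hn : 1 ≤ n) (r x plo phi qlo qhi vlo vhi lhi vfix : ℕ → ℝ)
    (hr : ∀ j, j ≤ n → 0 < r j) (hx : ∀ j, j ≤ n → 0 < x j)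
    (hA2 : ∀ j, j ≤ n+1 → vlo j = vfix j ∧ vhi j = vfix j ∧ 0 < vfix j)
    (Γ : ℝ × ℝ → ℝ) (hΓ : ConvexOn ℝ Set.univ Γ)
    (hexact : ∀ z : Pt, IsOptXc n r x plo phi qlo qhi vlo vhi lhi Γ z →
      ∀ j, j ≤ n → z.l j * z.v j = (z.P j)^2 + (z.Q j)^2)
    (z₁ z₂ : Pt)
    (h1 : IsOptXc n r x plo phi qlo qhi vlo vhi lhi Γ z₁)
    (h2 : IsOptXc n r x plo phi qlo qhi vlo vhi lhi Γ z₂) :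
    (∀ j, j ≤ n+1 → z₁.p j = z₂.p j ∧ z₁.q j = z₂.q j ∧ z₁.v j = z₂.v j) ∧
    (∀ j, j ≤ n → z₁.P j = z₂.P j ∧ z₁.Q j = z₂.Q j ∧ z₁.l j = z₂.l j) := by
  have hv : ∀ j, j ≤ n + 1 → z₁.v j = z₂.v j ∧ 0 < z₂.v j := by
    intro j h
    obtain ⟨hlo, hhi, hpos⟩ := hA2 j h
    have ha := h1.1.2.2.2.1 j h
    have hb := h2.1.2.2.2.1 j h
    rw [hlo, hhi] at ha hb
    constructor <;> linarith
  have hmid := h1.mid hΓ h2 fun j h => (hv j (by lia)).1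
  have hflow : ∀ j, j ≤ n → z₁.P j = z₂.P j ∧ z₁.Q j = z₂.Q j ∧ z₁.l j = z₂.l j := by
    intro j h
    have e1 := hexact z₁ h1 j h
    have e2 := hexact z₂ h2 j h
    have em := hexact _ hmid j h
    obtain ⟨hvj, hpos⟩ := hv j (by lia)
    simp only [Pt.mid] at em
    rw [hvj] at e1 em
    have hsum : (z₁.P j - z₂.P j) ^ 2 + (z₁.Q j - z₂.Q j) ^ 2 = 0 := by
      linear_combination 4 * em - 2 * e1 - 2 * e2
    have hP : z₁.P j = z₂.P j := by
      nlinarith [sq_nonneg (z₁.P j - z₂.P j), sq_nonneg (z₁.Q j - z₂.Q j)]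
    have hQ : z₁.Q j = z₂.Q j := by
      nlinarith [sq_nonneg (z₁.P j - z₂.P j), sq_nonneg (z₁.Q j - z₂.Q j)]
    refine ⟨hP, hQ, mul_right_cancel₀ hpos.ne' ?_⟩
    rw [e1, e2, hP, hQ]
  refine ⟨fun j h => ?_, hflow⟩
  obtain ⟨a1, a2, a3, a4, a5, a6, -⟩ := h1.1.1
  obtain ⟨b1, b2, b3, b4, b5, b6, -⟩ := h2.1.1
  suffices z₁.p j = z₂.p j ∧ z₁.q j = z₂.q j from ⟨this.1, this.2, (hv j h).1⟩
  obtain rfl | hj := Nat.eq_zero_or_pos j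
  · obtain ⟨hP, hQ, -⟩ := hflow 0 (by lia)
    exact ⟨by rw [a1, b1, hP], by rw [a2, b2, hQ]⟩
  obtain rfl | hlt := h.eq_or_lt
  · obtain ⟨hP, hQ, hl⟩ := hflow n le_rfl
    exact ⟨by rw [a5, b5, hP, hl], by rw [a6, b6, hQ, hl]⟩
  · have hjn : j ≤ n := by lia
    obtain ⟨hP, hQ, -⟩ := hflow j hjn
    obtain ⟨hP', hQ', hl'⟩ := hflow (j - 1) (by lia)
    exact ⟨by rw [a3 j hj hjn, b3 j hj hjn, hP, hP', hl'],
      by rw [a4 j hj hjn, b4 j hj hjn, hQ, hQ', hl']⟩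
end

section
/- (Lemma 5) Let r, x, v_i, v_j be positive reals, β := arctan(r/x), C := sqrt(v_i·v_j/(r² + x²)), and let I be the open interval (−arctan(x/r), arctan(x/r)). Define P(θ) := v_i·r/(r² + x²) + C·sin(θ − β) and φ(θ) := −v_j·r/(r² + x²) + C·sin(θ + β). Then for any θ₁ < θ₂ < θ₃ in I, (φ(θ₂) − φ(θ₁))·(P(θ₃) − P(θ₂)) > (φ(θ₃) − φ(θ₂))·(P(θ₂) − P(θ₁)); that is, the received real power φ is a strictly concave, strictly increasing function of the sent real power P. -/
open Real

/-- Sending-end real power flow on a line with impedance `r + i·x` between buses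
with fixed squared voltage magnitudes `vi, vj`, parametrized by the voltage
angle difference `θ`; `β = arctan (r/x)`, `C = sqrt (vi·vj/(r²+x²))`. -/
noncomputable def Pfun (r x vi vj θ : ℝ) : ℝ :=
  vi * r / (r^2 + x^2) + Real.sqrt (vi * vj / (r^2 + x^2)) * Real.sin (θ - Real.arctan (r/x))

/-- Received real power `φ = -P_{ji}` on the same line. -/
noncomputable def phifun (r x vi vj θ : ℝ) : ℝ :=
  -(vj * r / (r^2 + x^2)) + Real.sqrt (vi * vj / (r^2 + x^2)) * Real.sin (θ + Real.arctan (r/x))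

theorem sin_add_sub_sin_add (a b β : ℝ) :
    Real.sin (b + β) - Real.sin (a + β) =
      2 * Real.sin ((b - a) / 2) * Real.cos ((a + b) / 2 + β) := by
  rw [Real.sin_sub_sin]
  congr 3 <;> ring

theorem cos_add_mul_cos_sub_sub (m n β : ℝ) :
    Real.cos (m + β) * Real.cos (n - β) - Real.cos (n + β) * Real.cos (m - β) =
      Real.sin (2 * β) * Real.sin (n - m) := by
  rw [Real.sin_two_mul, Real.sin_sub, Real.cos_add, Real.cos_add, Real.cos_sub, Real.cos_sub]
  ring

theorem phifun_sub (r x vi vj a b : ℝ) :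
    phifun r x vi vj b - phifun r x vi vj a =
      Real.sqrt (vi * vj / (r^2 + x^2)) *
        (2 * Real.sin ((b - a) / 2) * Real.cos ((a + b) / 2 + Real.arctan (r/x))) := by
  rw [← sin_add_sub_sin_add]
  unfold phifun
  ring

theorem Pfun_sub (r x vi vj a b : ℝ) :
    Pfun r x vi vj b - Pfun r x vi vj a =
      Real.sqrt (vi * vj / (r^2 + x^2)) *
        (2 * Real.sin ((b - a) / 2) * Real.cos ((a + b) / 2 - Real.arctan (r/x))) := by
  rw [sub_eq_add_neg ((a + b) / 2), ← sin_add_sub_sin_add]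
  unfold Pfun
  ring_nf

/-- Lemma 5: for `θ₁ < θ₂ < θ₃` in `I = (-arctan(x/r), arctan(x/r))`,
`(φ(θ₂)-φ(θ₁))·(P(θ₃)-P(θ₂)) > (φ(θ₃)-φ(θ₂))·(P(θ₂)-P(θ₁))`: the received real
power `φ` is a strictly concave, strictly increasing function of the sent real
power `P`. -/
theorem stmt9 (r x vi vj : ℝ) (hr : 0 < r) (hx : 0 < x) (hvi : 0 < vi) (hvj : 0 < vj)
    (θ₁ θ₂ θ₃ : ℝ)
    (h1 : θ₁ ∈ Set.Ioo (-Real.arctan (x/r)) (Real.arctan (x/r)))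
    (h2 : θ₂ ∈ Set.Ioo (-Real.arctan (x/r)) (Real.arctan (x/r)))
    (h3 : θ₃ ∈ Set.Ioo (-Real.arctan (x/r)) (Real.arctan (x/r)))
    (h12 : θ₁ < θ₂) (h23 : θ₂ < θ₃) :
    (phifun r x vi vj θ₂ - phifun r x vi vj θ₁) * (Pfun r x vi vj θ₃ - Pfun r x vi vj θ₂) >
    (phifun r x vi vj θ₃ - phifun r x vi vj θ₂) * (Pfun r x vi vj θ₂ - Pfun r x vi vj θ₁) := by
  have hC : 0 < Real.sqrt (vi * vj / (r^2 + x^2)) := by positivity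
  have hlo := Real.neg_pi_div_two_lt_arctan (x/r)
  have hhi := Real.arctan_lt_pi_div_two (x/r)
  have sin_pos {a b : ℝ} (ha : a ∈ Set.Ioo (-Real.arctan (x/r)) (Real.arctan (x/r)))
      (hb : b ∈ Set.Ioo (-Real.arctan (x/r)) (Real.arctan (x/r))) (hab : a < b) :
      0 < Real.sin ((b - a) / 2) :=
    Real.sin_pos_of_pos_of_lt_pi (by linarith) (by linarith [ha.1, hb.2])
  have hβ : 0 < Real.sin (2 * Real.arctan (r/x)) :=
    Real.sin_pos_of_pos_of_lt_pi (by linarith [Real.arctan_pos.mpr (div_pos hr hx)])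
      (by linarith [Real.arctan_lt_pi_div_two (r/x)])
  have hcos := cos_add_mul_cos_sub_sub ((θ₁ + θ₂) / 2) ((θ₂ + θ₃) / 2) (Real.arctan (r/x))
  rw [show (θ₂ + θ₃) / 2 - (θ₁ + θ₂) / 2 = (θ₃ - θ₁) / 2 by ring] at hcos
  have hpos := mul_pos (mul_pos (mul_pos (pow_pos hC 2) (sin_pos h1 h2 h12)) (sin_pos h2 h3 h23))
    (mul_pos hβ (sin_pos h1 h3 (h12.trans h23)))
  rw [← hcos] at hpos
  rw [phifun_sub, phifun_sub, Pfun_sub, Pfun_sub]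
  linarith
end
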